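/- arXiv:2502.07739 — 4 statements merged into one kernel-verified Lean document; each statement's English description precedes it below -/
import Mathlib

section
/- Consider Asymmetric LoRA gradient flow for matrix factorization. (LSI case) Suppose the frozen adapter B_0 ∈ ℝ^{b×r} is random with a distribution invariant under left multiplication by every fixed orthogonal b×b matrix (e.g. i.i.d. Gaussian entries, or the first r columns of a Haar-random b×b orthogonal matrix) and rank(B_0) = r almost surely. Then for every t > 0, E[L_t] ≥ ((b−r)/(2b))·Σ_{i=1}^{min(a,b)} σ_i(M)², and E[L_t] → ((b−r)/(2b))·Σ_{i=1}^{min(a,b)} σ_i(M)² as t → ∞. (RSI case) If instead the frozen adapter A_0 ∈ ℝ^{a×r} is random with a distribution invariant under left multiplication by every fixed orthogonal a×a matrix and rank(A_0) = r almost surely, then for every t > 0, E[L_t] ≥ ((a−r)/(2a))·Σ_{i=1}^{min(a,b)} σ_i(M)², with equality in the limit t → ∞. -/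
open Matrix MeasureTheory Filter Topology

noncomputable section

/-- The measurable space structure on matrices (the product σ-algebra). -/
instance matrixMeasurableSpace {m n : Type*} : MeasurableSpace (Matrix m n ℝ) :=
  show MeasurableSpace (m → n → ℝ) from inferInstance

/-- Squared Frobenius norm of a real matrix. -/
def fnormSq {m n : ℕ} (M : Matrix (Fin m) (Fin n) ℝ) : ℝ := ∑ i, ∑ j, M i j ^ 2

/-- Frobenius norm of a real matrix. -/
def fnorm {m n : ℕ} (M : Matrix (Fin m) (Fin n) ℝ) : ℝ := Real.sqrt (fnormSq M)

/-- `X = (α/r) • B Aᵀ`, the LoRA update associated with adapters `A`, `B`. -/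
def lX {a b r : ℕ} (α : ℝ) (A : Matrix (Fin a) (Fin r) ℝ) (B : Matrix (Fin b) (Fin r) ℝ) :
    Matrix (Fin b) (Fin a) ℝ := (α / (r : ℝ)) • (B * Aᵀ)

/-- `Y = (α/r) • A Aᵀ`. -/
def lY {a r : ℕ} (α : ℝ) (A : Matrix (Fin a) (Fin r) ℝ) : Matrix (Fin a) (Fin a) ℝ :=
  (α / (r : ℝ)) • (A * Aᵀ)

/-- `Z = (α/r) • B Bᵀ`. -/
def lZ {b r : ℕ} (α : ℝ) (B : Matrix (Fin b) (Fin r) ℝ) : Matrix (Fin b) (Fin b) ℝ :=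
  (α / (r : ℝ)) • (B * Bᵀ)

/-- `G = (α/r) • (X - M)`, the gradient of the matrix-factorization loss. -/
def lG {a b r : ℕ} (α : ℝ) (M : Matrix (Fin b) (Fin a) ℝ) (A : Matrix (Fin a) (Fin r) ℝ)
    (B : Matrix (Fin b) (Fin r) ℝ) : Matrix (Fin b) (Fin a) ℝ :=
  (α / (r : ℝ)) • (lX α A B - M)

/-- The LoRA gradient flow on `[0, ∞)` for the matrix-factorization objective, with learning
rates `ηA` for the adapter `A` and `ηB` for the adapter `B`:
`dA/dt = -ηA Gᵀ B`, `dB/dt = -ηB G A`, stated entrywise. -/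
def LoraFlow {a b r : ℕ} (α ηA ηB : ℝ) (M : Matrix (Fin b) (Fin a) ℝ)
    (A : ℝ → Matrix (Fin a) (Fin r) ℝ) (B : ℝ → Matrix (Fin b) (Fin r) ℝ) : Prop :=
  ∀ t, (0 : ℝ) ≤ t →
    (∀ i j, HasDerivAt (fun s => A s i j) (((-ηA) • ((lG α M (A t) (B t))ᵀ * B t)) i j) t) ∧
    (∀ i j, HasDerivAt (fun s => B s i j) (((-ηB) • (lG α M (A t) (B t) * A t)) i j) t)

/-- The rectangular `b × a` diagonal matrix with diagonal entries `σ 0, σ 1, …`. -/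
def svdDiag (b a : ℕ) (σ : ℕ → ℝ) : Matrix (Fin b) (Fin a) ℝ :=
  Matrix.of fun i j => if (i : ℕ) = (j : ℕ) then σ (i : ℕ) else 0

/-- `M = U Σ Vᵀ` is a singular value decomposition of `M` with (nonincreasing, nonnegative)
singular values `σ 0 ≥ σ 1 ≥ …`, so that `σ i` is the `(i+1)`-th largest singular value,
the columns of `U` are corresponding left singular vectors and the columns of `V` are
corresponding right singular vectors. -/
def IsSVD {b a : ℕ} (M : Matrix (Fin b) (Fin a) ℝ) (U : Matrix (Fin b) (Fin b) ℝ)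
    (V : Matrix (Fin a) (Fin a) ℝ) (σ : ℕ → ℝ) : Prop :=
  U * Uᵀ = 1 ∧ Uᵀ * U = 1 ∧ V * Vᵀ = 1 ∧ Vᵀ * V = 1 ∧
    (∀ i j, i ≤ j → σ j ≤ σ i) ∧ (∀ i, 0 ≤ σ i) ∧ (∀ i, min a b ≤ i → σ i = 0) ∧
    M = U * svdDiag b a σ * Vᵀ

/-- Matrix exponential of `s B Bᵀ`. -/
def expE {b r : ℕ} (s : ℝ) (B : Matrix (Fin b) (Fin r) ℝ) : Matrix (Fin b) (Fin b) ℝ :=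
  NormedSpace.exp (s • (B * Bᵀ))

lemma expE_spec {b r : ℕ} (B : Matrix (Fin b) (Fin r) ℝ) :
    ∃ (U : Matrix (Fin b) (Fin b) ℝ) (l : Fin b → ℝ), U * Uᵀ = 1 ∧ Uᵀ * U = 1 ∧
      (∀ i, 0 ≤ l i) ∧ (Fintype.card {i // l i ≠ 0} = B.rank) ∧
      B * Bᵀ = U * diagonal l * Uᵀ ∧
      ∀ s, expE s B = U * diagonal (fun i => Real.exp (s * l i)) * Uᵀ := by
  have hA : (B * Bᵀ).IsHermitian := by
    have := isHermitian_mul_conjTranspose_self B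
    rwa [conjTranspose_eq_transpose_of_trivial] at this
  have hps : (B * Bᵀ).PosSemidef := by
    have := posSemidef_self_mul_conjTranspose B
    rwa [conjTranspose_eq_transpose_of_trivial] at this
  set V := hA.eigenvectorUnitary with hV
  have h1 : (V : Matrix (Fin b) (Fin b) ℝ) * (V : Matrix (Fin b) (Fin b) ℝ)ᵀ = 1 := by
    have := Unitary.coe_mul_star_self V
    rwa [Unitary.coe_star, star_eq_conjTranspose, conjTranspose_eq_transpose_of_trivial] at this
  have h2 : (V : Matrix (Fin b) (Fin b) ℝ)ᵀ * (V : Matrix (Fin b) (Fin b) ℝ) = 1 := by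
    have := Unitary.coe_star_mul_self V
    rwa [star_eq_conjTranspose, conjTranspose_eq_transpose_of_trivial] at this
  have h3 : B * Bᵀ = (V : Matrix (Fin b) (Fin b) ℝ) * diagonal hA.eigenvalues *
      (V : Matrix (Fin b) (Fin b) ℝ)ᵀ := by
    have := hA.spectral_theorem
    rw [Unitary.conjStarAlgAut_apply, star_eq_conjTranspose,
      conjTranspose_eq_transpose_of_trivial] at this
    exact this
  refine ⟨V, hA.eigenvalues, h1, h2, hps.eigenvalues_nonneg, ?_, h3, ?_⟩
  · rw [← hA.rank_eq_card_non_zero_eigs, rank_self_mul_transpose]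
  · intro s
    have hinv : (V : Matrix (Fin b) (Fin b) ℝ)⁻¹ = (V : Matrix (Fin b) (Fin b) ℝ)ᵀ :=
      inv_eq_right_inv h1
    have hu : IsUnit (V : Matrix (Fin b) (Fin b) ℝ) := IsUnit.of_mul_eq_one _ h1
    have h4 : s • (B * Bᵀ) = (V : Matrix (Fin b) (Fin b) ℝ) *
        diagonal (fun i => s * hA.eigenvalues i) * (V : Matrix (Fin b) (Fin b) ℝ)⁻¹ := by
      rw [hinv]
      have : diagonal (fun i => s * hA.eigenvalues i) = s • diagonal hA.eigenvalues := by
        rw [← diagonal_smul]; rfl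
      rw [this, Matrix.mul_smul, Matrix.smul_mul, ← h3]
    rw [expE, h4, Matrix.exp_conj _ _ hu, Matrix.exp_diagonal, hinv]
    congr 3
    ext i
    rw [Pi.coe_exp, Real.exp_eq_exp_ℝ]

lemma expE_cont {b r : ℕ} (s : ℝ) : Continuous (fun B : Matrix (Fin b) (Fin r) ℝ => expE s B) := by
  have h : Continuous (NormedSpace.exp : Matrix (Fin b) (Fin b) ℝ → Matrix (Fin b) (Fin b) ℝ) := by
    open scoped Norms.Operator in
    exact NormedSpace.exp_continuous
  unfold expE
  exact h.comp (by fun_prop)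

lemma expE_meas {b r : ℕ} (s : ℝ) (i j : Fin b) :
    Measurable (fun B : Matrix (Fin b) (Fin r) ℝ => expE s B i j) := by
  have hc : Continuous (fun B : Fin b → Fin r → ℝ => expE s (B : Matrix (Fin b) (Fin r) ℝ) i j) :=
    (continuous_apply j).comp ((continuous_apply i).comp (expE_cont s))
  exact hc.measurable

lemma expE_add {b r : ℕ} (s t : ℝ) (B : Matrix (Fin b) (Fin r) ℝ) :
    expE s B * expE t B = expE (s + t) B := by
  unfold expE
  rw [add_smul, Matrix.exp_add_of_commute]
  exact ((Commute.refl _).smul_left _).smul_right _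

lemma expE_zero {b r : ℕ} (B : Matrix (Fin b) (Fin r) ℝ) : expE 0 B = 1 := by
  simp [expE, NormedSpace.exp_zero]

lemma expE_symm {b r : ℕ} (s : ℝ) (B : Matrix (Fin b) (Fin r) ℝ) : (expE s B)ᵀ = expE s B := by
  unfold expE
  rw [← Matrix.exp_transpose]
  simp

lemma expE_conj {b r : ℕ} (s : ℝ) (B : Matrix (Fin b) (Fin r) ℝ)
    (Q : Matrix (Fin b) (Fin b) ℝ) (h1 : Q * Qᵀ = 1) :
    expE s (Q * B) = Q * expE s B * Qᵀ := by
  have hinv : Q⁻¹ = Qᵀ := inv_eq_right_inv h1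
  have hu : IsUnit Q := IsUnit.of_mul_eq_one _ h1
  have := Matrix.exp_conj Q (s • (B * Bᵀ)) hu
  rw [hinv] at this
  rw [expE, expE, ← this]
  congr 1
  simp [Matrix.mul_assoc]

lemma expE_deriv {b r : ℕ} (B : Matrix (Fin b) (Fin r) ℝ) (t : ℝ) (i j : Fin b) :
    HasDerivAt (fun s => expE s B i j) ((expE t B * (B * Bᵀ)) i j) t := by
  obtain ⟨U, l, h1, h2, -, -, h3, h4⟩ := expE_spec B
  have e1 : expE t B * (B * Bᵀ) = U * diagonal (fun i => Real.exp (t * l i) * l i) * Uᵀ := by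
    rw [h3, h4]
    calc _ = U * diagonal (fun i => Real.exp (t * l i)) * (Uᵀ * U) * diagonal l * Uᵀ := by
          simp only [Matrix.mul_assoc]
      _ = _ := by
          rw [h2, Matrix.mul_one, Matrix.mul_assoc U, diagonal_mul_diagonal]
  have e2 : ∀ d : Fin b → ℝ, (U * diagonal d * Uᵀ) i j = ∑ k, U i k * d k * U j k := by
    intro d
    rw [Matrix.mul_apply]
    simp [mul_diagonal]
  rw [e1]
  simp only [h4, e2]
  refine HasDerivAt.fun_sum fun k _ => ?_
  have := ((hasDerivAt_id t).mul_const (l k)).exp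
  simpa using (this.const_mul (U i k)).mul_const (U j k)

lemma expE_trace_spec {b r : ℕ} (B : Matrix (Fin b) (Fin r) ℝ) (hB : B.rank = r) (hrb : r ≤ b) :
    (∀ s, s ≤ 0 → (b : ℝ) - r ≤ (expE s B).trace) ∧
    Tendsto (fun s => (expE s B).trace) atBot (𝓝 ((b : ℝ) - r)) := by
  obtain ⟨U, l, h1, h2, hl, hc, h3, h4⟩ := expE_spec B
  have ht : ∀ s, (expE s B).trace = ∑ i, Real.exp (s * l i) := by
    intro s
    rw [h4, trace_mul_comm, ← Matrix.mul_assoc, h2, Matrix.one_mul, trace_diagonal]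
  have hsum : ∑ i, (if l i = 0 then (1 : ℝ) else 0) = (b : ℝ) - r := by
    have h5 : ∑ i, (if l i ≠ 0 then (1 : ℝ) else 0) = r := by
      rw [Finset.sum_boole, ← Fintype.card_subtype, hc, hB]
    have h6 : ∑ i, ((if l i = 0 then (1 : ℝ) else 0) + (if l i ≠ 0 then (1 : ℝ) else 0)) = b := by
      have : ∀ i, ((if l i = 0 then (1 : ℝ) else 0) + (if l i ≠ 0 then (1 : ℝ) else 0)) = 1 := by
        intro i; by_cases h : l i = 0 <;> simp [h]
      rw [Finset.sum_congr rfl fun i _ => this i]; simp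
    rw [Finset.sum_add_distrib, h5] at h6
    linarith
  rw [← hsum]
  simp only [ht]
  constructor
  · intro s _
    refine Finset.sum_le_sum fun i _ => ?_
    split_ifs with h
    · simp [h]
    · positivity
  · refine tendsto_finsetSum _ fun i _ => ?_
    split_ifs with h
    · simp [h]
    · have : 0 < l i := lt_of_le_of_ne (hl i) (Ne.symm h)
      exact Real.tendsto_exp_atBot.comp (tendsto_id.atBot_mul_const this)

lemma expE_bound {b r : ℕ} (B : Matrix (Fin b) (Fin r) ℝ) (s : ℝ) (hs : s ≤ 0) (i j : Fin b) :
    |expE s B i j| ≤ b := by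
  obtain ⟨U, l, h1, h2, hl, hc, h3, h4⟩ := expE_spec B
  have hU : U ∈ Matrix.unitaryGroup (Fin b) ℝ := by
    rw [Matrix.mem_unitaryGroup_iff, star_eq_conjTranspose, conjTranspose_eq_transpose_of_trivial]
    exact h1
  rw [h4, Matrix.mul_apply]
  simp only [mul_diagonal, transpose_apply]
  refine (Finset.abs_sum_le_sum_abs _ _).trans ?_
  have : ∀ k ∈ Finset.univ, |U i k * Real.exp (s * l k) * U j k| ≤ 1 := by
    intro k _
    have a1 := entry_norm_bound_of_unitary hU i k
    have a2 := entry_norm_bound_of_unitary hU j k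
    rw [Real.norm_eq_abs] at a1 a2
    have a3 : Real.exp (s * l k) ≤ 1 :=
      Real.exp_le_one_iff.2 (mul_nonpos_of_nonpos_of_nonneg hs (hl k))
    rw [abs_mul, abs_mul, abs_of_pos (Real.exp_pos _)]
    have := mul_le_one₀ a1 (Real.exp_pos (s * l k)).le a3
    exact mul_le_one₀ this (abs_nonneg _) a2
  refine (Finset.sum_le_sum this).trans ?_
  simp

lemma const_of_deriv {f : ℝ → ℝ} (h : ∀ t, 0 ≤ t → HasDerivAt f 0 t) (t : ℝ) (ht : 0 ≤ t) :
    f t = f 0 :=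
  constant_of_has_deriv_right_zero (a := 0) (b := t)
    (fun x hx => (h x hx.1).continuousAt.continuousWithinAt)
    (fun x hx => (h x hx.1).hasDerivWithinAt) t ⟨ht, le_rfl⟩

lemma flow_solution {a b r : ℕ} {α η : ℝ} {M : Matrix (Fin b) (Fin a) ℝ}
    {A : ℝ → Matrix (Fin a) (Fin r) ℝ} {B : ℝ → Matrix (Fin b) (Fin r) ℝ}
    (hA : A 0 = 0) (hf : LoraFlow α η 0 M A B) (t : ℝ) (ht : 0 ≤ t) :
    lX α (A t) (B t) - M = -(expE (-(η * (α / r) ^ 2) * t) (B 0) * M) := by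
  have hB : ∀ t, 0 ≤ t → B t = B 0 := by
    intro t ht
    ext i j
    refine const_of_deriv (f := fun s => B s i j) (fun s hs => ?_) t ht
    simpa using (hf s hs).2 i j
  set c : ℝ := α / r with hc
  set κ : ℝ := η * c ^ 2 with hκ
  set R : ℝ → Matrix (Fin b) (Fin a) ℝ := fun t => lX α (A t) (B 0) - M with hR
  have hRd : ∀ t, 0 ≤ t → ∀ i j, HasDerivAt (fun s => R s i j)
      (-κ * ((B 0 * (B 0)ᵀ) * R t) i j) t := by
    intro t ht i j
    have h1 : (-κ * ((B 0 * (B 0)ᵀ) * R t) i j) =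
        c * ∑ k, B 0 i k * ((-η) • ((lG α M (A t) (B t))ᵀ * B t)) j k := by
      rw [hB t ht]
      have h2 : ((B 0 * (B 0)ᵀ) * R t) i j = ∑ k, B 0 i k * ((R t)ᵀ * B 0) j k := by
        rw [Matrix.mul_assoc, Matrix.mul_apply]
        refine Finset.sum_congr rfl fun k _ => ?_
        rw [← Matrix.transpose_apply ((B 0)ᵀ * R t), Matrix.transpose_mul, transpose_transpose]
      rw [h2, Finset.mul_sum, Finset.mul_sum]
      refine Finset.sum_congr rfl fun k _ => ?_
      have h3 : lG α M (A t) (B 0) = c • R t := rfl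
      rw [h3, transpose_smul, Matrix.smul_mul]
      simp only [Matrix.smul_apply, smul_eq_mul, hκ]
      ring
    rw [h1]
    have h4 : (fun s => R s i j) = fun s => c * ∑ k, B 0 i k * A s j k - M i j := by
      ext s
      simp [hR, lX, Matrix.mul_apply, hc]
    rw [h4]
    refine HasDerivAt.sub_const _ (HasDerivAt.const_mul c (HasDerivAt.fun_sum fun k _ => ?_))
    exact ((hf t ht).1 j k).const_mul _
  have hF : ∀ i j, (expE (κ * t) (B 0) * R t) i j = (expE (κ * 0) (B 0) * R 0) i j := by
    intro i j
    refine const_of_deriv (f := fun t => (expE (κ * t) (B 0) * R t) i j) (fun s hs => ?_) t ht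
    simp only [Matrix.mul_apply (M := expE _ (B 0))]
    have h0 : (0 : ℝ) = ∑ k, (((expE (κ * s) (B 0) * (B 0 * (B 0)ᵀ)) i k * κ) * R s k j +
        expE (κ * s) (B 0) i k * (-κ * ((B 0 * (B 0)ᵀ) * R s) k j)) := by
      rw [Finset.sum_add_distrib]
      have e1 : ∑ k, ((expE (κ * s) (B 0) * (B 0 * (B 0)ᵀ)) i k * κ) * R s k j
          = κ * (expE (κ * s) (B 0) * (B 0 * (B 0)ᵀ) * R s) i j := by
        rw [Matrix.mul_apply, Finset.mul_sum]
        exact Finset.sum_congr rfl fun k _ => by ring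
      have e2 : ∑ k, expE (κ * s) (B 0) i k * (-κ * ((B 0 * (B 0)ᵀ) * R s) k j)
          = -κ * (expE (κ * s) (B 0) * ((B 0 * (B 0)ᵀ) * R s)) i j := by
        rw [Matrix.mul_apply, Finset.mul_sum]
        exact Finset.sum_congr rfl fun k _ => by ring
      rw [e1, e2, ← Matrix.mul_assoc (expE (κ * s) (B 0)) (B 0 * (B 0)ᵀ) (R s)]
      ring
    refine HasDerivAt.congr_deriv ?_ h0.symm
    refine HasDerivAt.fun_sum fun k _ => ?_
    refine HasDerivAt.fun_mul ?_ (hRd s hs k j)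
    have := (expE_deriv (B 0) (κ * s) i k).comp s ((hasDerivAt_id s).const_mul κ)
    rw [mul_one] at this
    exact this
  have hF' : expE (κ * t) (B 0) * R t = -M := by
    have : expE (κ * t) (B 0) * R t = expE (κ * 0) (B 0) * R 0 := by
      ext i j; exact hF i j
    rw [this, mul_zero, expE_zero, Matrix.one_mul]
    simp [hR, lX, hA]
  have h5 : R t = expE (-κ * t) (B 0) * (expE (κ * t) (B 0) * R t) := by
    rw [← Matrix.mul_assoc, expE_add]
    have : -κ * t + κ * t = 0 := by ring
    rw [this, expE_zero, Matrix.one_mul]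
  rw [hB t ht]
  change R t = _
  rw [h5, hF', Matrix.mul_neg]

lemma fnormSq_eq_trace {m n : ℕ} (N : Matrix (Fin m) (Fin n) ℝ) :
    fnormSq N = (Nᵀ * N).trace := by
  simp only [fnormSq, Matrix.trace, diag_apply, Matrix.mul_apply, transpose_apply]
  rw [Finset.sum_comm]
  simp only [sq]

lemma fnormSq_transpose {m n : ℕ} (N : Matrix (Fin m) (Fin n) ℝ) :
    fnormSq Nᵀ = fnormSq N := by
  simp only [fnormSq, transpose_apply]
  rw [Finset.sum_comm]

lemma fnormSq_exp {a b r : ℕ} (s : ℝ) (B : Matrix (Fin b) (Fin r) ℝ)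
    (M : Matrix (Fin b) (Fin a) ℝ) :
    fnormSq (-(expE s B * M)) = ∑ i, ∑ k, (M * Mᵀ) k i * expE (2 * s) B i k := by
  rw [fnormSq_eq_trace, transpose_neg, Matrix.neg_mul, Matrix.mul_neg, neg_neg, transpose_mul, expE_symm,
    Matrix.mul_assoc, ← Matrix.mul_assoc (expE s B), expE_add, ← two_mul, trace_mul_comm,
    Matrix.mul_assoc]
  simp only [Matrix.trace, diag_apply]
  refine Finset.sum_congr rfl fun i _ => ?_
  rw [Matrix.mul_apply]
  exact Finset.sum_congr rfl fun k _ => mul_comm _ _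

lemma fnormSq_svd {a b : ℕ} {M : Matrix (Fin b) (Fin a) ℝ}
    {U : Matrix (Fin b) (Fin b) ℝ} {V : Matrix (Fin a) (Fin a) ℝ} {σ : ℕ → ℝ}
    (h : IsSVD M U V σ) : fnormSq M = ∑ i ∈ Finset.range (min a b), σ i ^ 2 := by
  obtain ⟨-, hU, -, hV, -, -, h0, hM⟩ := h
  have h1 : fnormSq M = fnormSq (svdDiag b a σ) := by
    rw [fnormSq_eq_trace, fnormSq_eq_trace, hM]
    set D := svdDiag b a σ
    have : (U * D * Vᵀ)ᵀ * (U * D * Vᵀ) = V * (Dᵀ * D * Vᵀ) := by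
      calc _ = V * Dᵀ * (Uᵀ * U) * D * Vᵀ := by
            simp only [transpose_mul, transpose_transpose, Matrix.mul_assoc]
        _ = _ := by rw [hU]; simp only [Matrix.mul_one, Matrix.mul_assoc]
    rw [this, trace_mul_comm, Matrix.mul_assoc, hV, Matrix.mul_one]
  rw [h1]
  have h2 : ∀ i : Fin b, ∑ j : Fin a, svdDiag b a σ i j ^ 2 =
      if (i : ℕ) < min a b then σ i ^ 2 else 0 := by
    intro i
    simp only [svdDiag, of_apply]
    by_cases hi : (i : ℕ) < a
    · rw [Finset.sum_eq_single ⟨i, hi⟩]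
      · simp [hi]
      · intro j _ hj
        have : (i : ℕ) ≠ j := fun h => hj (Fin.ext h.symm)
        simp [this]
      · simp
    · rw [if_neg (by omega)]
      refine Finset.sum_eq_zero fun j _ => ?_
      have : (i : ℕ) ≠ j := by omega
      simp [this]
  simp only [fnormSq, h2]
  rw [Fin.sum_univ_eq_sum_range (fun i => if i < min a b then σ i ^ 2 else 0), ← Finset.sum_filter]
  refine Finset.sum_congr ?_ fun _ _ => rfl
  ext i; simp only [Finset.mem_filter, Finset.mem_range]; omega

lemma expE_integrable {b r : ℕ} {Ω : Type*} [MeasurableSpace Ω] (μ : Measure Ω)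
    [IsProbabilityMeasure μ] (B0 : Ω → Matrix (Fin b) (Fin r) ℝ) (hm : Measurable B0)
    (s : ℝ) (hs : s ≤ 0) (i j : Fin b) : Integrable (fun ω => expE s (B0 ω) i j) μ :=
  Integrable.of_bound ((expE_meas s i j).comp hm).aestronglyMeasurable b
    (ae_of_all _ fun ω => by
      rw [Real.norm_eq_abs]; exact expE_bound (B0 ω) s hs i j)

lemma expE_inv {b r : ℕ} {Ω : Type*} [MeasurableSpace Ω] (μ : Measure Ω)
    (B0 : Ω → Matrix (Fin b) (Fin r) ℝ) (hm : Measurable B0)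
    (hinv : ∀ Q : Matrix (Fin b) (Fin b) ℝ, Q * Qᵀ = 1 →
      Measure.map (fun ω => Q * B0 ω) μ = Measure.map B0 μ)
    (s : ℝ) (i j : Fin b) (Q : Matrix (Fin b) (Fin b) ℝ) (hQ : Q * Qᵀ = 1) :
    ∫ ω, (Q * expE s (B0 ω) * Qᵀ) i j ∂μ = ∫ ω, expE s (B0 ω) i j ∂μ := by
  have hQm : Measurable (fun B : Matrix (Fin b) (Fin r) ℝ => Q * B) := by
    refine measurable_pi_lambda _ fun i => measurable_pi_lambda _ fun j => ?_
    simp only [Matrix.mul_apply]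
    refine Finset.measurable_sum _ fun k _ => Measurable.const_mul ?_ _
    exact (measurable_pi_apply j).comp (measurable_pi_apply (X := fun _ => Fin r → ℝ) k)
  have hm' : Measurable (fun ω => Q * B0 ω) := hQm.comp hm
  have e1 := integral_map (μ := μ) hm.aemeasurable
    (f := fun B => expE s B i j) (expE_meas s i j).aestronglyMeasurable
  have e2 := integral_map (μ := μ) hm'.aemeasurable
    (f := fun B => expE s B i j) (expE_meas s i j).aestronglyMeasurable
  rw [hinv Q hQ, e1] at e2
  rw [e2]
  simp only [expE_conj s _ Q hQ]

lemma expE_mean {b r : ℕ} {Ω : Type*} [MeasurableSpace Ω] (μ : Measure Ω)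
    [IsProbabilityMeasure μ]
    (B0 : Ω → Matrix (Fin b) (Fin r) ℝ) (hm : Measurable B0)
    (hinv : ∀ Q : Matrix (Fin b) (Fin b) ℝ, Q * Qᵀ = 1 →
      Measure.map (fun ω => Q * B0 ω) μ = Measure.map B0 μ)
    (s : ℝ) (hs : s ≤ 0) (i j : Fin b) :
    ∫ ω, expE s (B0 ω) i j ∂μ = if i = j then (∫ ω, (expE s (B0 ω)).trace ∂μ) / b else 0 := by
  split_ifs with h
  · subst h
    have hd : ∀ k, ∫ ω, expE s (B0 ω) k k ∂μ = ∫ ω, expE s (B0 ω) i i ∂μ := by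
      intro k
      have hsw : Matrix.swap ℝ i k * (Matrix.swap ℝ i k)ᵀ = 1 := by
        rw [show (Matrix.swap ℝ i k)ᵀ = Matrix.swap ℝ i k by simp]
        exact Matrix.swap_mul_self i k
      rw [← expE_inv μ B0 hm hinv s i i (Matrix.swap ℝ i k) hsw]
      congr 1
      ext ω
      rw [show (Matrix.swap ℝ i k)ᵀ = Matrix.swap ℝ i k by simp]
      simp
    have ht : ∫ ω, (expE s (B0 ω)).trace ∂μ = b * ∫ ω, expE s (B0 ω) i i ∂μ := by
      simp only [Matrix.trace, diag_apply]
      rw [integral_finsetSum _ fun k _ => expE_integrable μ B0 hm s hs k k]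
      simp [hd]
    have hb : (b : ℝ) ≠ 0 := by
      have := i.pos
      positivity
    rw [ht]; field_simp
  · set d : Fin b → ℝ := fun k => if k = i then -1 else 1 with hd
    have hdd : diagonal d * (diagonal d)ᵀ = 1 := by
      rw [diagonal_transpose, diagonal_mul_diagonal, ← diagonal_one]
      congr 1; ext k; simp only [hd]; split_ifs <;> norm_num
    have := expE_inv μ B0 hm hinv s i j (diagonal d) hdd
    have h2 : ∀ ω, (diagonal d * expE s (B0 ω) * (diagonal d)ᵀ) i j = - expE s (B0 ω) i j := by
      intro ω
      rw [diagonal_transpose, mul_diagonal, diagonal_mul]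
      simp [hd, Ne.symm h]
    simp only [h2, integral_neg] at this
    linarith

lemma lsi_main {a b r : ℕ} (hb : 0 < b) (hr0 : 0 < r) (hrb : r ≤ b)
    {α η : ℝ} (hα : 0 < α) (hη : 0 < η) (M : Matrix (Fin b) (Fin a) ℝ)
    {Ω : Type*} [MeasurableSpace Ω] (μ : Measure Ω) [IsProbabilityMeasure μ]
    (B0 : Ω → Matrix (Fin b) (Fin r) ℝ) (hm : Measurable B0)
    (hinv : ∀ Q : Matrix (Fin b) (Fin b) ℝ, Q * Qᵀ = 1 →
      Measure.map (fun ω => Q * B0 ω) μ = Measure.map B0 μ)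
    (hrank : ∀ᵐ ω ∂μ, (B0 ω).rank = r)
    (A : Ω → ℝ → Matrix (Fin a) (Fin r) ℝ) (B : Ω → ℝ → Matrix (Fin b) (Fin r) ℝ)
    (h0 : ∀ ω, A ω 0 = 0 ∧ B ω 0 = B0 ω)
    (hflow : ∀ ω, LoraFlow α η 0 M (A ω) (B ω)) :
    (∀ t : ℝ, 0 < t → ((b : ℝ) - r) / (2 * b) * fnormSq M ≤
        ∫ ω, (1 / 2) * fnormSq (lX α (A ω t) (B ω t) - M) ∂μ) ∧
    Tendsto (fun t : ℝ => ∫ ω, (1 / 2) * fnormSq (lX α (A ω t) (B ω t) - M) ∂μ) atTop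
      (𝓝 (((b : ℝ) - r) / (2 * b) * fnormSq M)) := by
  set κ : ℝ := η * (α / r) ^ 2 with hκ
  have hκ0 : 0 < κ := by positivity
  have hM0 : 0 ≤ fnormSq M := by unfold fnormSq; positivity
  have hbR : (0 : ℝ) < b := by positivity
  have hint : ∀ s ≤ 0, Integrable (fun ω => (expE s (B0 ω)).trace) μ := by
    intro s hs
    simp only [Matrix.trace, diag_apply]
    exact integrable_finsetSum _ fun k _ => expE_integrable μ B0 hm s hs k k
  have key : ∀ t : ℝ, 0 ≤ t → ∫ ω, (1 / 2) * fnormSq (lX α (A ω t) (B ω t) - M) ∂μ =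
      (∫ ω, (expE (2 * (-κ * t)) (B0 ω)).trace ∂μ) / (2 * b) * fnormSq M := by
    intro t ht
    have hs : 2 * (-κ * t) ≤ 0 := by nlinarith
    have e1 : ∀ ω, (1 / 2) * fnormSq (lX α (A ω t) (B ω t) - M) =
        (1 / 2) * ∑ i, ∑ k, (M * Mᵀ) k i * expE (2 * (-κ * t)) (B0 ω) i k := by
      intro ω
      rw [flow_solution (h0 ω).1 (hflow ω) t ht, (h0 ω).2, fnormSq_exp]
    simp only [e1]
    have hi : ∀ i k, Integrable (fun ω => (M * Mᵀ) k i * expE (2 * (-κ * t)) (B0 ω) i k) μ :=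
      fun i k => (expE_integrable μ B0 hm _ hs i k).const_mul _
    rw [integral_const_mul, integral_finsetSum _ fun i _ => integrable_finsetSum _ fun k _ => hi i k]
    simp only [integral_finsetSum _ fun k _ => hi _ k, integral_const_mul,
      expE_mean μ B0 hm hinv _ hs]
    simp only [mul_ite, mul_zero, Finset.sum_ite_eq, Finset.mem_univ, if_true]
    rw [← Finset.sum_mul, fnormSq_eq_trace, trace_mul_comm, Matrix.trace]
    simp only [diag_apply]
    field_simp
  have hlow : ∀ t : ℝ, 0 ≤ t → (b : ℝ) - r ≤ ∫ ω, (expE (2 * (-κ * t)) (B0 ω)).trace ∂μ := by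
    intro t ht
    have hs : 2 * (-κ * t) ≤ 0 := by nlinarith
    have : ∫ _ω, ((b : ℝ) - r) ∂μ ≤ ∫ ω, (expE (2 * (-κ * t)) (B0 ω)).trace ∂μ := by
      refine integral_mono_ae (integrable_const _) (hint _ hs) ?_
      filter_upwards [hrank] with ω hω
      exact (expE_trace_spec (B0 ω) hω hrb).1 _ hs
    simpa using this
  constructor
  · intro t ht
    rw [key t ht.le]
    have := hlow t ht.le
    gcongr
  · have hlim : Tendsto (fun t : ℝ => ∫ ω, (expE (2 * (-κ * t)) (B0 ω)).trace ∂μ) atTop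
        (𝓝 (∫ _ω, ((b : ℝ) - r) ∂μ)) := by
      refine tendsto_integral_filter_of_dominated_convergence (fun _ => (b : ℝ) * b) ?_ ?_
        (integrable_const _) ?_
      · filter_upwards [eventually_ge_atTop 0] with t ht
        exact (hint _ (by nlinarith)).aestronglyMeasurable
      · filter_upwards [eventually_ge_atTop 0] with t ht
        refine ae_of_all _ fun ω => ?_
        rw [Real.norm_eq_abs, Matrix.trace]
        refine (Finset.abs_sum_le_sum_abs _ _).trans ?_
        refine (Finset.sum_le_sum fun i _ =>
          expE_bound (B0 ω) (2 * (-κ * t)) (by nlinarith) i i).trans ?_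
        simp
      · filter_upwards [hrank] with ω hω
        refine (expE_trace_spec (B0 ω) hω hrb).2.comp ?_
        have : (fun t : ℝ => 2 * (-κ * t)) = fun t => (2 * -κ) * t := by ext; ring
        rw [this]
        exact tendsto_id.const_mul_atTop_of_neg (by linarith)
    simp only [integral_const, probReal_univ, one_smul] at hlim
    have := (hlim.div_const (2 * (b : ℝ))).mul_const (fnormSq M)
    refine this.congr' ?_
    filter_upwards [eventually_ge_atTop 0] with t ht
    exact (key t ht).symm

lemma lX_transpose {a b r : ℕ} (α : ℝ) (A : Matrix (Fin a) (Fin r) ℝ)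
    (B : Matrix (Fin b) (Fin r) ℝ) : lX α B A = (lX α A B)ᵀ := by
  simp [lX]

lemma flow_transpose {a b r : ℕ} {α η : ℝ} {M : Matrix (Fin b) (Fin a) ℝ}
    {A : ℝ → Matrix (Fin a) (Fin r) ℝ} {B : ℝ → Matrix (Fin b) (Fin r) ℝ}
    (hf : LoraFlow α 0 η M A B) : LoraFlow α η 0 Mᵀ B A := by
  intro t ht
  have hG : lG α Mᵀ (B t) (A t) = (lG α M (A t) (B t))ᵀ := by
    simp only [lG, lX_transpose α (A t) (B t), transpose_smul, transpose_sub]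
  rw [hG, transpose_transpose]
  exact ⟨(hf t ht).2, (hf t ht).1⟩

/-- For Asymmetric LoRA gradient flow on the matrix-factorization objective,
with a frozen random adapter whose law is invariant under left multiplication by orthogonal
matrices and which has full rank `r` almost surely: in the LSI case the expected loss is
bounded below by `((b-r)/(2b)) Σ σᵢ(M)²` for every `t > 0` and tends to this value as `t → ∞`;
in the RSI case the same holds with `((a-r)/(2a)) Σ σᵢ(M)²`. -/
theorem statement0
    (a b r : ℕ) (ha : 0 < a) (hb : 0 < b) (hr0 : 0 < r) (hr : r ≤ min a b)
    (α η : ℝ) (hα : 0 < α) (hη : 0 < η)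
    (M : Matrix (Fin b) (Fin a) ℝ)
    (UM : Matrix (Fin b) (Fin b) ℝ) (VM : Matrix (Fin a) (Fin a) ℝ) (σ : ℕ → ℝ)
    (hsvd : IsSVD M UM VM σ)
    {Ω : Type*} [MeasurableSpace Ω] (μ : Measure Ω) [IsProbabilityMeasure μ]
    -- LSI case: random frozen adapter `B₀`, orthogonally invariant law, full rank a.s.
    (B0 : Ω → Matrix (Fin b) (Fin r) ℝ) (hB0meas : Measurable B0)
    (hB0inv : ∀ Q : Matrix (Fin b) (Fin b) ℝ, Q * Qᵀ = 1 →
      Measure.map (fun ω => Q * B0 ω) μ = Measure.map B0 μ)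
    (hB0rank : ∀ᵐ ω ∂μ, (B0 ω).rank = r)
    (AL : Ω → ℝ → Matrix (Fin a) (Fin r) ℝ) (BL : Ω → ℝ → Matrix (Fin b) (Fin r) ℝ)
    (hL0 : ∀ ω, AL ω 0 = 0 ∧ BL ω 0 = B0 ω)
    (hLflow : ∀ ω, LoraFlow α η 0 M (AL ω) (BL ω))
    -- RSI case: random frozen adapter `A₀`, orthogonally invariant law, full rank a.s.
    (A0 : Ω → Matrix (Fin a) (Fin r) ℝ) (hA0meas : Measurable A0)
    (hA0inv : ∀ Q : Matrix (Fin a) (Fin a) ℝ, Q * Qᵀ = 1 →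
      Measure.map (fun ω => Q * A0 ω) μ = Measure.map A0 μ)
    (hA0rank : ∀ᵐ ω ∂μ, (A0 ω).rank = r)
    (AR : Ω → ℝ → Matrix (Fin a) (Fin r) ℝ) (BR : Ω → ℝ → Matrix (Fin b) (Fin r) ℝ)
    (hR0 : ∀ ω, AR ω 0 = A0 ω ∧ BR ω 0 = 0)
    (hRflow : ∀ ω, LoraFlow α 0 η M (AR ω) (BR ω)) :
    (∀ t : ℝ, 0 < t →
      ((b : ℝ) - r) / (2 * b) * ∑ i ∈ Finset.range (min a b), σ i ^ 2 ≤
        ∫ ω, (1 / 2) * fnormSq (lX α (AL ω t) (BL ω t) - M) ∂μ) ∧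
    Tendsto (fun t : ℝ => ∫ ω, (1 / 2) * fnormSq (lX α (AL ω t) (BL ω t) - M) ∂μ) atTop
      (𝓝 (((b : ℝ) - r) / (2 * b) * ∑ i ∈ Finset.range (min a b), σ i ^ 2)) ∧
    (∀ t : ℝ, 0 < t →
      ((a : ℝ) - r) / (2 * a) * ∑ i ∈ Finset.range (min a b), σ i ^ 2 ≤
        ∫ ω, (1 / 2) * fnormSq (lX α (AR ω t) (BR ω t) - M) ∂μ) ∧
    Tendsto (fun t : ℝ => ∫ ω, (1 / 2) * fnormSq (lX α (AR ω t) (BR ω t) - M) ∂μ) atTop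
      (𝓝 (((a : ℝ) - r) / (2 * a) * ∑ i ∈ Finset.range (min a b), σ i ^ 2)) := by
  have hr' := le_min_iff.1 hr
  have hL := lsi_main hb hr0 hr'.2 hα hη M μ B0 hB0meas hB0inv hB0rank AL BL hL0 hLflow
  have hR := lsi_main ha hr0 hr'.1 hα hη Mᵀ μ A0 hA0meas hA0inv hA0rank BR AR
    (fun ω => ⟨(hR0 ω).2, (hR0 ω).1⟩) (fun ω => flow_transpose (hRflow ω))
  have hT : ∀ ω t, fnormSq (lX α (BR ω t) (AR ω t) - Mᵀ) =
      fnormSq (lX α (AR ω t) (BR ω t) - M) := by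
    intro ω t
    rw [lX_transpose α (AR ω t) (BR ω t), ← transpose_sub, fnormSq_transpose]
  simp only [hT, fnormSq_transpose] at hR
  rw [fnormSq_svd hsvd] at hL hR
  exact ⟨hL.1, hL.2, hR.1, hR.2⟩


end
end

section
/- Under the general-loss comparison setting with zero+random initialization (A_0 = 0 or B_0 = 0, so X_0 = 0 and ‖Y_0‖_F·‖Z_0‖_F = 0), the classic LoRA trajectory X_t and the Asymmetric LoRA trajectory X̃_t started from the same initialization satisfy, for all t ≥ 0, ‖X_t − X̃_t‖_F ≤ 2ηRt · e^{ηK(‖Z_0‖_F + ‖Y_0‖_F)t} · (‖Z_0‖_F + ‖Y_0‖_F) · (e^{2ηR√r t} − 1)². -/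
open Matrix MeasureTheory Filter Topology

noncomputable section

attribute [local instance] Matrix.frobeniusNormedAddCommGroup Matrix.frobeniusNormedSpace

theorem fnorm_eq_norm {m n : ℕ} (M : Matrix (Fin m) (Fin n) ℝ) : fnorm M = ‖M‖ := by
  rw [Matrix.frobenius_norm_def, fnorm, fnormSq, Real.sqrt_eq_rpow]
  simp

theorem norm_transpose_frob {m n : ℕ} (M : Matrix (Fin m) (Fin n) ℝ) : ‖Mᵀ‖ = ‖M‖ :=
  Matrix.frobenius_norm_transpose M

theorem hasDeriv_of_entry {m n : ℕ} {P : ℝ → Matrix (Fin m) (Fin n) ℝ}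
    {P' : Matrix (Fin m) (Fin n) ℝ} {t : ℝ}
    (h : ∀ i j, HasDerivAt (fun s => P s i j) (P' i j) t) : HasDerivAt P P' t := by
  have e : ∀ M : Matrix (Fin m) (Fin n) ℝ,
      M = ∑ i, ∑ j, (M i j) • Matrix.single i j (1:ℝ) := by
    intro M
    conv_lhs => rw [Matrix.matrix_eq_sum_single M]
    simp [Matrix.smul_single]
  have e2 : P = fun s => ∑ i, ∑ j, (P s i j) • Matrix.single i j (1:ℝ) := by
    funext s; exact e (P s)
  rw [e2, e P']
  refine HasDerivAt.fun_sum fun i _ => HasDerivAt.fun_sum fun j _ => ?_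
  exact (h i j).smul_const _

theorem entry_mul {m n p : ℕ} {P : ℝ → Matrix (Fin m) (Fin n) ℝ}
    {P' : Matrix (Fin m) (Fin n) ℝ} {Q : ℝ → Matrix (Fin n) (Fin p) ℝ}
    {Q' : Matrix (Fin n) (Fin p) ℝ} {t : ℝ}
    (h : ∀ i j, HasDerivAt (fun s => P s i j) (P' i j) t)
    (k : ∀ i j, HasDerivAt (fun s => Q s i j) (Q' i j) t) :
    ∀ i j, HasDerivAt (fun s => (P s * Q s) i j) ((P' * Q t + P t * Q') i j) t := by
  intro i j
  simp only [Matrix.mul_apply, Matrix.add_apply, ← Finset.sum_add_distrib]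
  exact HasDerivAt.fun_sum fun l _ => (h i l).mul (k l j)

theorem hasDeriv_smul_mul {m n p : ℕ} (c : ℝ) {P : ℝ → Matrix (Fin m) (Fin n) ℝ}
    {P' : Matrix (Fin m) (Fin n) ℝ} {Q : ℝ → Matrix (Fin p) (Fin n) ℝ}
    {Q' : Matrix (Fin p) (Fin n) ℝ} {t : ℝ}
    (h : ∀ i j, HasDerivAt (fun s => P s i j) (P' i j) t)
    (k : ∀ i j, HasDerivAt (fun s => Q s i j) (Q' i j) t) :
    HasDerivAt (fun s => c • (P s * (Q s)ᵀ)) (c • (P' * (Q t)ᵀ + P t * Q'ᵀ)) t := by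
  have := hasDeriv_of_entry (entry_mul (Q := fun s => (Q s)ᵀ) (Q' := Q'ᵀ) h (fun i j => k j i))
  exact this.const_smul c

theorem gron_zero {E : Type*} [NormedAddCommGroup E] [NormedSpace ℝ E] {f f' : ℝ → E} {k ε : ℝ}
    (hf : ∀ t, 0 ≤ t → HasDerivAt f (f' t) t) (h0 : f 0 = 0) (T : ℝ) (hT : 0 ≤ T)
    (hb : ∀ t, 0 ≤ t → t ≤ T → ‖f' t‖ ≤ k * ‖f t‖ + ε) : ‖f T‖ ≤ gronwallBound 0 k ε T := by
  have := norm_le_gronwallBound_of_norm_deriv_right_le (f := f) (f' := f') (δ := 0) (K := k)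
    (ε := ε) (a := 0) (b := T) (fun x hx => (hf x hx.1).continuousAt.continuousWithinAt)
    (fun x hx => (hf x hx.1).hasDerivWithinAt) (by simp [h0])
    (fun x hx => hb x hx.1 hx.2.le) T ⟨hT, le_rfl⟩
  simpa using this

theorem gron_le {k ε T : ℝ} (hk : 0 ≤ k) (hε : 0 ≤ ε) (hT : 0 ≤ T) :
    gronwallBound 0 k ε T ≤ ε * T * Real.exp (k * T) := by
  rcases hk.eq_or_lt with h | h
  · subst h; simp [gronwallBound_K0]
  · rw [gronwallBound_of_K_ne_0 h.ne']
    have h1 : Real.exp (k * T) - 1 ≤ k * T * Real.exp (k * T) := by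
      have := Real.add_one_le_exp (-(k * T))
      have h2 : Real.exp (-(k*T)) * Real.exp (k*T) = 1 := by rw [← Real.exp_add]; simp
      nlinarith [Real.exp_pos (k * T)]
    have : ε / k * (Real.exp (k * T) - 1) ≤ ε / k * (k * T * Real.exp (k * T)) := by gcongr
    calc _ ≤ ε / k * (k * T * Real.exp (k * T)) := by simpa using this
      _ = _ := by field_simp

theorem bound_int {E : Type*} [NormedAddCommGroup E] [NormedSpace ℝ E] {f f' : ℝ → E} {ρ s : ℝ}
    (hf : ∀ t, 0 ≤ t → HasDerivAt f (f' t) t) (h0 : f 0 = 0)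
    (hb : ∀ t, 0 ≤ t → ‖f' t‖ ≤ ρ * s * (Real.exp (2 * ρ * t) - 1)) (T : ℝ) (hT : 0 ≤ T) :
    ‖f T‖ ≤ s / 2 * (Real.exp (2 * ρ * T) - 1 - 2 * ρ * T) := by
  refine image_norm_le_of_norm_deriv_right_le_deriv_boundary (f := f) (f' := f') (a := 0) (b := T)
    (B := fun t => s / 2 * (Real.exp (2 * ρ * t) - 1 - 2 * ρ * t))
    (B' := fun t => ρ * s * (Real.exp (2 * ρ * t) - 1))
    (fun x hx => (hf x hx.1).continuousAt.continuousWithinAt)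
    (fun x hx => (hf x hx.1).hasDerivWithinAt) (by simp [h0]) ?_
    (fun x hx => hb x hx.1) ⟨hT, le_rfl⟩
  intro x
  have h1 : HasDerivAt (fun t : ℝ => 2 * ρ * t) (2 * ρ) x := by
    simpa using (hasDerivAt_id x).const_mul (2 * ρ)
  have := ((h1.exp.sub_const 1).sub h1).const_mul (s / 2)
  exact this.congr_deriv (by ring)

theorem exp_aux {y w : ℝ} (hy : 0 ≤ y) (hw : y ≤ w) :
    Real.exp y - 1 - y ≤ (Real.exp w - 1) ^ 2 := by
  have h1 := Real.add_one_le_exp (-y)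
  have h2 : Real.exp (-y) * Real.exp y = 1 := by rw [← Real.exp_add]; simp
  have h3 : 1 ≤ Real.exp y := Real.one_le_exp hy
  have h4 : Real.exp y ≤ Real.exp w := Real.exp_le_exp.2 hw
  have h5 : (1 - y) * Real.exp y ≤ 1 := by nlinarith
  have h6 : (Real.exp y - 1) ^ 2 ≤ (Real.exp w - 1) ^ 2 := by
    apply pow_le_pow_left₀ <;> linarith
  have h7 : 0 ≤ y * (Real.exp y - 1) := mul_nonneg hy (by linarith)
  have h8 : Real.exp y - 1 ≤ y * Real.exp y := by linarith
  have h9 : y + 1 ≤ Real.exp y := Real.add_one_le_exp y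
  nlinarith

/-- Abstract comparison. -/
theorem core {a b : ℕ} {η R K q : ℝ} (hη : 0 < η) (hR : 0 ≤ R) (hK : 0 ≤ K) (hq : 1 ≤ q)
    (g : Matrix (Fin b) (Fin a) ℝ → Matrix (Fin b) (Fin a) ℝ)
    (hgR : ∀ X, ‖g X‖ ≤ R) (hgK : ∀ X X', ‖g X - g X'‖ ≤ K * ‖X - X'‖)
    (X W : ℝ → Matrix (Fin b) (Fin a) ℝ) (Y : ℝ → Matrix (Fin a) (Fin a) ℝ)
    (Z : ℝ → Matrix (Fin b) (Fin b) ℝ)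
    (hX : ∀ t, 0 ≤ t → HasDerivAt X ((-η) • (Z t * g (X t) + g (X t) * Y t)) t)
    (hY : ∀ t, 0 ≤ t → HasDerivAt Y ((-η) • ((g (X t))ᵀ * X t + (X t)ᵀ * g (X t))) t)
    (hZ : ∀ t, 0 ≤ t → HasDerivAt Z ((-η) • (g (X t) * (X t)ᵀ + X t * (g (X t))ᵀ)) t)
    (hW : ∀ t, 0 ≤ t → HasDerivAt W ((-η) • (Z 0 * g (W t) + g (W t) * Y 0)) t)
    (hX0 : X 0 = 0) (hW0 : W 0 = 0) (T : ℝ) (hT : 0 ≤ T) :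
    ‖X T - W T‖ ≤ 2 * η * R * T * Real.exp (η * K * (‖Z 0‖ + ‖Y 0‖) * T) *
      (‖Z 0‖ + ‖Y 0‖) * (Real.exp (2 * η * R * q * T) - 1) ^ 2 := by
  set s := ‖Z 0‖ + ‖Y 0‖ with hs
  have hs0 : 0 ≤ s := by positivity
  have hmul : ∀ {m n p : ℕ} (M : Matrix (Fin m) (Fin n) ℝ) (N : Matrix (Fin n) (Fin p) ℝ)
      {x y : ℝ}, ‖M‖ ≤ x → ‖N‖ ≤ y → ‖M * N‖ ≤ x * y := by
    intro m n p M N x y h1 h2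
    refine (Matrix.frobenius_norm_mul M N).trans ?_
    exact mul_le_mul h1 h2 (norm_nonneg _) ((norm_nonneg _).trans h1)
  have hsm : ∀ {m n : ℕ} (M : Matrix (Fin m) (Fin n) ℝ) {x : ℝ}, ‖M‖ ≤ x → ‖(-η) • M‖ ≤ η * x := by
    intro m n M x h
    rw [norm_smul, norm_neg, Real.norm_of_nonneg hη.le]
    gcongr
  have hYb : ∀ t, ‖(-η) • ((g (X t))ᵀ * X t + (X t)ᵀ * g (X t))‖ ≤ 2 * (η * R) * ‖X t‖ := by
    intro t
    refine (hsm _ (norm_add_le_of_le (hmul _ _ ((norm_transpose_frob _).le.trans (hgR _)) le_rfl)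
      (hmul _ _ (norm_transpose_frob _).le (hgR _)))).trans (le_of_eq ?_)
    ring
  have hZb : ∀ t, ‖(-η) • (g (X t) * (X t)ᵀ + X t * (g (X t))ᵀ)‖ ≤ 2 * (η * R) * ‖X t‖ := by
    intro t
    refine (hsm _ (norm_add_le_of_le (hmul _ _ (hgR _) (norm_transpose_frob _).le)
      (hmul _ _ le_rfl ((norm_transpose_frob _).le.trans (hgR _))))).trans (le_of_eq ?_)
    ring
  have hYd : ∀ t, 0 ≤ t → HasDerivAt (fun t => Y t - Y 0) _ t :=
    fun t ht => (hY t ht).sub_const (Y 0)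
  have hZd : ∀ t, 0 ≤ t → HasDerivAt (fun t => Z t - Z 0) _ t :=
    fun t ht => (hZ t ht).sub_const (Z 0)
  have hρ : 0 ≤ η * R := by positivity
  have hx : ∀ t, 0 ≤ t → ‖X t‖ ≤ s / 2 * (Real.exp (2 * (η * R) * t) - 1) := by
    intro t ht
    have h1 := gron_zero (f := fun t => (X t, Z t - Z 0, Y t - Y 0)) (k := 2 * (η * R))
      (ε := η * R * s)
      (fun t ht => (hX t ht).prodMk ((hZd t ht).prodMk (hYd t ht))) (by simp [hX0]) t ht (by
        intro u hu _
        have n1 : ‖X u‖ ≤ ‖(X u, Z u - Z 0, Y u - Y 0)‖ := norm_fst_le (X u, Z u - Z 0, Y u - Y 0)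
        have n2 : ‖(Z u - Z 0, Y u - Y 0)‖ ≤ ‖(X u, Z u - Z 0, Y u - Y 0)‖ :=
          norm_snd_le (X u, Z u - Z 0, Y u - Y 0)
        have n3 := (norm_fst_le (Z u - Z 0, Y u - Y 0)).trans n2
        have n4 := (norm_snd_le (Z u - Z 0, Y u - Y 0)).trans n2
        set N := ‖(X u, Z u - Z 0, Y u - Y 0)‖
        simp only at n3 n4
        have m : 2 * (η * R) * ‖X u‖ ≤ 2 * (η * R) * N + η * R * s := by
          have : 2 * (η * R) * ‖X u‖ ≤ 2 * (η * R) * N := by gcongr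
          have : 0 ≤ η * R * s := by positivity
          linarith
        refine norm_prod_le_iff.2 ⟨?_, norm_prod_le_iff.2 ⟨(hZb u).trans m, (hYb u).trans m⟩⟩
        have z1 : ‖Z u‖ ≤ ‖Z 0‖ + N := by
          have := norm_add_le (Z 0) (Z u - Z 0)
          rw [add_sub_cancel] at this
          linarith
        have y1 : ‖Y u‖ ≤ ‖Y 0‖ + N := by
          have := norm_add_le (Y 0) (Y u - Y 0)
          rw [add_sub_cancel] at this
          linarith
        refine (hsm _ (norm_add_le_of_le (hmul _ _ z1 (hgR _))
          (hmul _ _ (hgR _) y1))).trans (le_of_eq ?_)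
        rw [hs]; ring)
    have h2 : ‖X t‖ ≤ ‖(X t, Z t - Z 0, Y t - Y 0)‖ := norm_fst_le (X t, Z t - Z 0, Y t - Y 0)
    refine (h2.trans h1).trans (le_of_eq ?_)
    rcases hρ.eq_or_lt with h | h
    · rw [← h]; simp [gronwallBound_K0]
    · rw [gronwallBound_of_K_ne_0 (by positivity)]
      have hR' : R ≠ 0 := by rintro rfl; simp at h
      field_simp
      ring
  have hb2 : ∀ t, 0 ≤ t →
      2 * (η * R) * ‖X t‖ ≤ (η * R) * s * (Real.exp (2 * (η * R) * t) - 1) := by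
    intro t ht
    have := mul_le_mul_of_nonneg_left (hx t ht) (by positivity : 0 ≤ 2 * (η * R))
    refine this.trans (le_of_eq ?_)
    ring
  have hy : ∀ t, 0 ≤ t →  ‖Y t - Y 0‖ ≤ _ := fun t ht =>
    bound_int hYd (by simp) (fun t ht => (hYb t).trans (hb2 t ht)) t ht
  have hz : ∀ t, 0 ≤ t →  ‖Z t - Z 0‖ ≤ _ := fun t ht =>
    bound_int hZd (by simp) (fun t ht => (hZb t).trans (hb2 t ht)) t ht
  set U := s * (Real.exp (2 * η * R * q * T) - 1) ^ 2 with hU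
  have hU0 : 0 ≤ U := by positivity
  have hu : ∀ t, 0 ≤ t → t ≤ T → ‖Y t - Y 0‖ + ‖Z t - Z 0‖ ≤ U := by
    intro t ht htT
    have h1 : 2 * (η * R) * t ≤ 2 * η * R * q * T := by
      have : 2 * (η * R) * t ≤ 2 * (η * R) * (q * T) := by
        gcongr
        nlinarith
      linarith
    have h2 := mul_le_mul_of_nonneg_left
      (exp_aux (by positivity : 0 ≤ 2 * (η * R) * t) h1) hs0
    have := hy t ht
    have := hz t ht
    linarith
  have hD := gron_zero (f := fun t => X t - W t) (k := η * K * s) (ε := η * R * U)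
    (fun t ht => (hX t ht).sub (hW t ht)) (by simp [hX0, hW0]) T hT (by
      intro t ht htT
      have e : (-η) • (Z t * g (X t) + g (X t) * Y t) - (-η) • (Z 0 * g (W t) + g (W t) * Y 0)
          = (-η) • (((Z t - Z 0) * g (X t) + g (X t) * (Y t - Y 0)) +
            (Z 0 * (g (X t) - g (W t)) + (g (X t) - g (W t)) * Y 0)) := by
        rw [← smul_sub]
        congr 1
        simp only [Matrix.sub_mul, Matrix.mul_sub]
        abel
      simp only [e]
      refine (hsm _ (norm_add_le_of_le
        (norm_add_le_of_le (hmul _ _ le_rfl (hgR _)) (hmul _ _ (hgR _) le_rfl))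
        (norm_add_le_of_le (hmul _ _ le_rfl (hgK _ _)) (hmul _ _ (hgK _ _) le_rfl)))).trans ?_
      have := mul_le_mul_of_nonneg_left (hu t ht htT) hρ
      rw [hs]
      linarith)
  refine (hD.trans (gron_le (by positivity) (by positivity) hT)).trans ?_
  have : 0 ≤ η * R * U * T * Real.exp (η * K * s * T) := by positivity
  calc _ ≤ 2 * (η * R * U * T * Real.exp (η * K * s * T)) := by linarith
    _ = _ := by rw [hU]; ring

/-- Under a bounded, Lipschitz gradient calculator `g` and zero+random
initialization (`A₀ = 0` or `B₀ = 0`), the classic LoRA trajectory `Xₜ` and the Asymmetric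
LoRA trajectory `X̃ₜ` started from the same initialization satisfy
`‖Xₜ - X̃ₜ‖_F ≤ 2ηRt e^{ηK(‖Z₀‖+‖Y₀‖)t} (‖Z₀‖+‖Y₀‖)(e^{2ηR√r t} - 1)²` for all `t ≥ 0`. -/
theorem statement2
    (a b r : ℕ) (hr0 : 0 < r) (hr : r ≤ min a b)
    (α η R K : ℝ) (hα : 0 < α) (hη : 0 < η)
    (g : Matrix (Fin b) (Fin a) ℝ → Matrix (Fin b) (Fin a) ℝ)
    (hgR : ∀ X, fnorm (g X) ≤ R)
    (hgK : ∀ X X', fnorm (g X - g X') ≤ K * fnorm (X - X'))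
    (A : ℝ → Matrix (Fin a) (Fin r) ℝ) (B : ℝ → Matrix (Fin b) (Fin r) ℝ)
    (hA : ∀ t, (0:ℝ) ≤ t → ∀ i j, HasDerivAt (fun s => A s i j)
      (((-η) • ((g (lX α (A t) (B t)))ᵀ * B t)) i j) t)
    (hB : ∀ t, (0:ℝ) ≤ t → ∀ i j, HasDerivAt (fun s => B s i j)
      (((-η) • (g (lX α (A t) (B t)) * A t)) i j) t)
    (hinit : A 0 = 0 ∨ B 0 = 0)
    (Xt : ℝ → Matrix (Fin b) (Fin a) ℝ)
    (hXt0 : Xt 0 = lX α (A 0) (B 0))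
    (hXt : ∀ t, (0:ℝ) ≤ t → ∀ i j, HasDerivAt (fun s => Xt s i j)
      (((-η) • (lZ α (B 0) * g (Xt t) + g (Xt t) * lY α (A 0))) i j) t) :
    ∀ t, (0:ℝ) ≤ t →
      fnorm (lX α (A t) (B t) - Xt t) ≤
        2 * η * R * t * Real.exp (η * K * (fnorm (lZ α (B 0)) + fnorm (lY α (A 0))) * t) *
          (fnorm (lZ α (B 0)) + fnorm (lY α (A 0))) *
          (Real.exp (2 * η * R * Real.sqrt r * t) - 1) ^ 2 := by
  intro t ht
  simp only [fnorm_eq_norm] at *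
  have hR : 0 ≤ R := (norm_nonneg _).trans (hgR 0)
  have ha : 0 < a := lt_of_lt_of_le hr0 (hr.trans (min_le_left _ _))
  have hb : 0 < b := lt_of_lt_of_le hr0 (hr.trans (min_le_right _ _))
  have hK : 0 ≤ K := by
    by_contra hK
    push Not at hK
    have h1 := (norm_nonneg _).trans (hgK (Matrix.single ⟨0, hb⟩ ⟨0, ha⟩ 1) 0)
    have h2 : 0 < ‖(Matrix.single ⟨0, hb⟩ ⟨0, ha⟩ 1 : Matrix (Fin b) (Fin a) ℝ) - 0‖ := by
      rw [sub_zero, norm_pos_iff]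
      intro h
      have := congrFun (congrFun h ⟨0, hb⟩) ⟨0, ha⟩
      simp at this
    nlinarith
  have hq : 1 ≤ Real.sqrt r := by
    rw [Real.one_le_sqrt]
    exact_mod_cast hr0
  have hX0 : lX α (A 0) (B 0) = 0 := by
    rcases hinit with h | h <;> simp [lX, h]
  refine core hη hR hK hq g hgR hgK (fun t => lX α (A t) (B t)) Xt (fun t => lY α (A t))
    (fun t => lZ α (B t)) ?_ ?_ ?_ (fun t ht => hasDeriv_of_entry (hXt t ht)) hX0
    (hXt0.trans hX0) t ht
  · intro t ht
    have := hasDeriv_smul_mul (α / r) (hB t ht) (hA t ht)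
    refine HasDerivAt.congr_deriv this ?_
    symm
    simp only [lZ, lY, Matrix.transpose_smul, Matrix.transpose_mul, Matrix.transpose_transpose,
      Matrix.smul_mul, Matrix.mul_smul, smul_add, Matrix.mul_assoc]
    rw [add_comm, smul_comm (-η) (α / (r : ℝ)), smul_comm (-η) (α / (r : ℝ))]
  · intro t ht
    have := hasDeriv_smul_mul (α / r) (hA t ht) (hA t ht)
    refine HasDerivAt.congr_deriv this ?_
    symm
    generalize g _ = G
    simp only [lX, Matrix.transpose_smul, Matrix.transpose_mul, Matrix.transpose_transpose,
      Matrix.smul_mul, Matrix.mul_smul, smul_add, Matrix.mul_assoc]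
    rw [smul_comm (-η) (α / (r : ℝ)), smul_comm (-η) (α / (r : ℝ))]
  · intro t ht
    have := hasDeriv_smul_mul (α / r) (hB t ht) (hB t ht)
    refine HasDerivAt.congr_deriv this ?_
    symm
    generalize g _ = G
    simp only [lX, Matrix.transpose_smul, Matrix.transpose_mul, Matrix.transpose_transpose,
      Matrix.smul_mul, Matrix.mul_smul, smul_add, Matrix.mul_assoc]
    rw [smul_comm (-η) (α / (r : ℝ)), smul_comm (-η) (α / (r : ℝ))]


end
end

section
/- Consider Asymmetric LoRA gradient flow for matrix factorization with LSI (η_A = η, η_B = 0, A_0 = 0, B_0 ∈ ℝ^{b×r} arbitrary), and let P ∈ ℝ^{b×b} be the orthogonal projection onto the column space of B_0. Then X_t → PM as t → ∞. -/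
open Matrix MeasureTheory Filter Topology

noncomputable section

theorem aux_const (f : ℝ → ℝ) (hf : ∀ t, 0 ≤ t → HasDerivAt f 0 t) (t : ℝ) (ht : 0 ≤ t) :
    f t = f 0 := by
  refine constant_of_has_deriv_right_zero (a := 0) (b := t) (f := f) ?_ ?_ t ⟨ht, le_rfl⟩
  · intro x hx
    exact (hf x hx.1).continuousAt.continuousWithinAt
  · intro x hx
    exact (hf x hx.1).hasDerivWithinAt

theorem aux_decay (f : ℝ → ℝ) (k : ℝ) (hk : 0 < k)
    (hf : ∀ t, 0 ≤ t → HasDerivAt f (-k * f t) t) : Tendsto f atTop (𝓝 0) := by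
  have h1 : ∀ t, 0 ≤ t → f t * Real.exp (k * t) = f 0 := by
    intro t ht
    have := aux_const (fun t => f t * Real.exp (k * t)) ?_ t ht
    · simpa using this
    · intro s hs
      have he : HasDerivAt (fun t => Real.exp (k * t)) (Real.exp (k * s) * (k * 1)) s :=
        ((hasDerivAt_id s).const_mul k).exp
      have := (hf s hs).mul he
      exact this.congr_deriv (by ring)
  have h2 : ∀ t, 0 ≤ t → f t = f 0 * Real.exp (-(k * t)) := by
    intro t ht
    rw [← h1 t ht, mul_assoc, ← Real.exp_add]
    simp
  have h3 : Tendsto (fun t => f 0 * Real.exp (-(k * t))) atTop (𝓝 (f 0 * 0)) :=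
    (Real.tendsto_exp_neg_atTop_nhds_zero.comp
      (tendsto_id.const_mul_atTop hk)).const_mul (f 0)
  rw [mul_zero] at h3
  refine h3.congr' ?_
  filter_upwards [eventually_ge_atTop 0] with t ht
  exact (h2 t ht).symm

theorem aux_factor {m n p : ℕ} (P : Matrix (Fin m) (Fin n) ℝ) (B : Matrix (Fin m) (Fin p) ℝ)
    (h : LinearMap.range P.mulVecLin ≤ LinearMap.range B.mulVecLin) :
    ∃ K : Matrix (Fin p) (Fin n) ℝ, P = B * K := by
  have h1 : ∀ j, ∃ v : Fin p → ℝ, B *ᵥ v = P.col j := by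
    intro j
    have : P.col j ∈ LinearMap.range B.mulVecLin := h ⟨Pi.single j 1, by simp⟩
    simpa using this
  choose v hv using h1
  refine ⟨Matrix.of fun i j => v j i, ?_⟩
  ext i j
  have := congrFun (hv j) i
  simp only [Matrix.col_apply] at this
  rw [← this]
  rfl

theorem aux_spec {b r : ℕ} (B : Matrix (Fin b) (Fin r) ℝ) :
    ∃ (U : Matrix (Fin b) (Fin b) ℝ) (d : Fin b → ℝ), U * Uᵀ = 1 ∧
      Uᵀ * (B * Bᵀ) = diagonal d * Uᵀ ∧ (∀ i, 0 ≤ d i) ∧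
      ∀ i, d i = 0 → ∀ l, (Uᵀ * B) i l = 0 := by
  have hps : (B * Bᵀ).PosSemidef := by
    simpa using Matrix.posSemidef_self_mul_conjTranspose B
  have hS := hps.isHermitian
  let U : Matrix (Fin b) (Fin b) ℝ := hS.eigenvectorUnitary
  have hU1 : U * Uᵀ = 1 := by
    have := Unitary.mul_star_self_of_mem hS.eigenvectorUnitary.2
    simpa [star_eq_conjTranspose] using this
  have hU2 : Uᵀ * U = 1 := mul_eq_one_comm.mp hU1
  have hspec : B * Bᵀ = U * diagonal hS.eigenvalues * Uᵀ := by
    have := hS.spectral_theorem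
    rw [Unitary.conjStarAlgAut_apply] at this
    simpa [star_eq_conjTranspose, U, Function.comp_def] using this
  have hD : Uᵀ * (B * Bᵀ) = diagonal hS.eigenvalues * Uᵀ := by
    refine (congrArg (fun N => Uᵀ * N) hspec).trans ?_
    rw [← Matrix.mul_assoc, ← Matrix.mul_assoc, hU2, Matrix.one_mul]
  refine ⟨U, hS.eigenvalues, hU1, hD, hps.eigenvalues_nonneg, ?_⟩
  intro i hi l
  have h1 : (Uᵀ * B) * (Uᵀ * B)ᵀ = diagonal hS.eigenvalues := by
    rw [transpose_mul, transpose_transpose, Matrix.mul_assoc, ← Matrix.mul_assoc B,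
      ← Matrix.mul_assoc, hD, Matrix.mul_assoc, hU2, Matrix.mul_one]
  have h2 := congrFun (congrFun h1 i) i
  rw [diagonal_apply_eq, hi, Matrix.mul_apply] at h2
  simp only [Matrix.transpose_apply (Uᵀ * B)] at h2
  have := (Finset.sum_eq_zero_iff_of_nonneg (fun l _ => mul_self_nonneg _)).1 h2 l
    (Finset.mem_univ l)
  exact mul_self_eq_zero.1 this

/-- For Asymmetric LoRA gradient flow with LSI (`ηA = η`, `ηB = 0`,
`A₀ = 0`, `B₀` arbitrary), if `P` is the orthogonal projection onto the column space of
`B₀` then `Xₜ → P M` as `t → ∞`. -/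
theorem statement10
    (a b r : ℕ) (hr0 : 0 < r) (hr : r ≤ min a b)
    (α η : ℝ) (hα : 0 < α) (hη : 0 < η)
    (M : Matrix (Fin b) (Fin a) ℝ)
    (A : ℝ → Matrix (Fin a) (Fin r) ℝ) (B : ℝ → Matrix (Fin b) (Fin r) ℝ)
    (hA0 : A 0 = 0)
    (hflow : LoraFlow α η 0 M A B)
    (P : Matrix (Fin b) (Fin b) ℝ) (hPsymm : Pᵀ = P) (hPidem : P * P = P)
    (hPrange : LinearMap.range P.mulVecLin = LinearMap.range (B 0).mulVecLin) :
    ∀ i j, Tendsto (fun t => lX α (A t) (B t) i j) atTop (𝓝 ((P * M) i j)) := by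
  have hc : 0 < α / (r : ℝ) := div_pos hα (by exact_mod_cast hr0)
  have hB : ∀ t, 0 ≤ t → B t = B 0 := by
    intro t ht
    ext i j
    refine aux_const (fun s => B s i j) ?_ t ht
    intro s hs
    simpa using (hflow s hs).2 i j
  obtain ⟨K, hK⟩ := aux_factor P (B 0) hPrange.le
  obtain ⟨L, hL⟩ := aux_factor (B 0) P hPrange.ge
  obtain ⟨U, d, hU, hD, hd, hd0⟩ := aux_spec (B 0)
  generalize hB0 : B 0 = B₀ at *
  generalize hcc : α / (r : ℝ) = c at *
  have hPB : P * B₀ = B₀ := by rw [hL, ← Matrix.mul_assoc, hPidem]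
  have hBP : B₀ᵀ * P = B₀ᵀ := by
    have := congrArg transpose hPB
    rwa [transpose_mul, hPsymm] at this
  -- the error in the eigenbasis
  have hW : ∀ i j, Tendsto (fun t => (Uᵀ * (c • (B₀ * (A t)ᵀ) - P * M)) i j) atTop (𝓝 0) := by
    intro i j
    rcases (hd i).eq_or_lt with h0 | hpos
    · have : ∀ t, (Uᵀ * (c • (B₀ * (A t)ᵀ) - P * M)) i j = 0 := by
        intro t
        have e : Uᵀ * (c • (B₀ * (A t)ᵀ) - P * M) = (Uᵀ * B₀) * (c • (A t)ᵀ - K * M) := by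
          rw [hK]
          simp only [Matrix.mul_sub, Matrix.mul_smul, Matrix.mul_assoc]
        rw [e, Matrix.mul_apply]
        exact Finset.sum_eq_zero fun l _ => by rw [hd0 i h0.symm l, zero_mul]
      simp only [this]
      exact tendsto_const_nhds
    · refine aux_decay _ (c ^ 2 * η * d i) (by positivity) ?_
      intro t ht
      have e : (fun s => (Uᵀ * (c • (B₀ * (A s)ᵀ) - P * M)) i j) =
          fun s => c * (∑ l, (Uᵀ * B₀) i l * A s j l) - (Uᵀ * (P * M)) i j := by
        funext s
        rw [Matrix.mul_sub, Matrix.mul_smul, ← Matrix.mul_assoc, Matrix.sub_apply,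
          Matrix.smul_apply, Matrix.mul_apply, smul_eq_mul]
        rfl
      have hder : HasDerivAt (fun s => c * (∑ l, (Uᵀ * B₀) i l * A s j l) - (Uᵀ * (P * M)) i j)
          (c * (∑ l, (Uᵀ * B₀) i l * (((-η) • ((lG α M (A t) (B t))ᵀ * B t)) j l))) t := by
        refine HasDerivAt.sub_const _ (HasDerivAt.const_mul c ?_)
        refine HasDerivAt.fun_sum fun l _ => HasDerivAt.const_mul _ ?_
        exact (hflow t ht).1 j l
      rw [e]
      convert hder using 1
      rw [hB t ht]
      have e2 : ∑ l, (Uᵀ * B₀) i l * (((-η) • ((lG α M (A t) B₀)ᵀ * B₀)) j l)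
          = ((Uᵀ * B₀) * ((-η) • ((lG α M (A t) B₀)ᵀ * B₀))ᵀ) i j := by
        rw [Matrix.mul_apply]; rfl
      rw [e2]
      have e3 : (Uᵀ * B₀) * ((-η) • ((lG α M (A t) B₀)ᵀ * B₀))ᵀ
          = (-(η * c)) • (diagonal d * (Uᵀ * (c • (B₀ * (A t)ᵀ) - P * M))) := by
        have e4 : Uᵀ * (B₀ * B₀ᵀ) * (P * M) = Uᵀ * (B₀ * B₀ᵀ) * M := by
          rw [← Matrix.mul_assoc, Matrix.mul_assoc Uᵀ, Matrix.mul_assoc B₀, hBP]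
        rw [← Matrix.mul_assoc (diagonal d), ← hD, Matrix.mul_sub, e4, ← Matrix.mul_sub]
        simp only [lG, lX, hcc, transpose_smul, transpose_mul, transpose_transpose,
          Matrix.mul_smul, Matrix.smul_mul, Matrix.mul_assoc, smul_smul, neg_mul]
      rw [e3, Matrix.smul_apply, Matrix.diagonal_mul, smul_eq_mul]
      ring
  intro i j
  have key : Tendsto (fun t => ∑ l, U i l * (Uᵀ * (c • (B₀ * (A t)ᵀ) - P * M)) l j + (P * M) i j)
      atTop (𝓝 (∑ l, U i l * 0 + (P * M) i j)) :=
    (tendsto_finsetSum _ fun l _ => (hW l j).const_mul _).add_const _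
  simp only [mul_zero, Finset.sum_const_zero, zero_add] at key
  refine key.congr' ?_
  filter_upwards [eventually_ge_atTop 0] with t ht
  rw [← Matrix.mul_apply, ← Matrix.mul_assoc, hU, Matrix.one_mul, hB t ht, Matrix.sub_apply,
    sub_add_cancel, lX, hcc]

end
end

section
/- Consider classic LoRA gradient flow (η_A = η_B = η) for matrix factorization. Suppose σ > 0, u ∈ ℝ^b and v ∈ ℝ^a satisfy Mv = σu and Mᵀu = σv (a singular value/vector pair of M), and suppose the initialization satisfies X_0 v = 0, Y_0 v = 0, X_0ᵀ u = 0 and Z_0 u = 0. Then for all t ≥ 0: X_t v = 0, Y_t v = 0, X_tᵀ u = 0 and Z_t u = 0. -/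
open Matrix MeasureTheory Filter Topology

noncomputable section

/-- For classic LoRA gradient flow (`ηA = ηB = η`) on the
matrix-factorization objective, if `(σ, u, v)` is a singular triple of `M` (`Mv = σu`,
`Mᵀu = σv`, `σ > 0`) and the initialization satisfies `X₀ v = 0`, `Y₀ v = 0`, `X₀ᵀ u = 0`
and `Z₀ u = 0`, then these four identities hold for all `t ≥ 0`. -/
theorem statement14
    (a b r : ℕ) (hr0 : 0 < r) (hr : r ≤ min a b)
    (α η : ℝ) (hα : 0 < α) (hη : 0 < η)
    (M : Matrix (Fin b) (Fin a) ℝ)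
    (A : ℝ → Matrix (Fin a) (Fin r) ℝ) (B : ℝ → Matrix (Fin b) (Fin r) ℝ)
    (hflow : LoraFlow α η η M A B)
    (σ : ℝ) (hσ : 0 < σ) (u : Fin b → ℝ) (v : Fin a → ℝ)
    (hMv : M *ᵥ v = σ • u) (hMu : Mᵀ *ᵥ u = σ • v)
    (hX0 : lX α (A 0) (B 0) *ᵥ v = 0)
    (hY0 : lY α (A 0) *ᵥ v = 0)
    (hX0' : (lX α (A 0) (B 0))ᵀ *ᵥ u = 0)
    (hZ0 : lZ α (B 0) *ᵥ u = 0) :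
    ∀ t, (0:ℝ) ≤ t →
      lX α (A t) (B t) *ᵥ v = 0 ∧
      lY α (A t) *ᵥ v = 0 ∧
      (lX α (A t) (B t))ᵀ *ᵥ u = 0 ∧
      lZ α (B t) *ᵥ u = 0 := by
  have hr' : (0:ℝ) < r := by exact_mod_cast hr0
  set c : ℝ := α / (r:ℝ) with hc
  have hc0 : 0 < c := div_pos hα hr'
  have hp0 : (A 0)ᵀ *ᵥ v = 0 := by
    have h1 : c • (((A 0) * (A 0)ᵀ) *ᵥ v) = 0 := by
      simpa [lY, smul_mulVec, ← hc] using hY0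
    have h2 := (smul_eq_zero.mp h1).resolve_left hc0.ne'
    rw [← mulVec_mulVec] at h2
    have h3 : v ⬝ᵥ (A 0 *ᵥ ((A 0)ᵀ *ᵥ v)) = 0 := by rw [h2, dotProduct_zero]
    rw [dotProduct_mulVec, ← mulVec_transpose] at h3
    exact dotProduct_self_eq_zero.mp h3
  have hq0 : (B 0)ᵀ *ᵥ u = 0 := by
    have h1 : c • (((B 0) * (B 0)ᵀ) *ᵥ u) = 0 := by
      simpa [lZ, smul_mulVec, ← hc] using hZ0
    have h2 := (smul_eq_zero.mp h1).resolve_left hc0.ne'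
    rw [← mulVec_mulVec] at h2
    have h3 : u ⬝ᵥ (B 0 *ᵥ ((B 0)ᵀ *ᵥ u)) = 0 := by rw [h2, dotProduct_zero]
    rw [dotProduct_mulVec, ← mulVec_transpose] at h3
    exact dotProduct_self_eq_zero.mp h3
  set p : ℝ → Fin r → ℝ := fun t => (A t)ᵀ *ᵥ v with hp
  set q : ℝ → Fin r → ℝ := fun t => (B t)ᵀ *ᵥ u with hq
  let dpt : ℝ → Fin r → ℝ := fun t => (-(η * c)) • (c • ((B t)ᵀ *ᵥ (B t *ᵥ p t)) - σ • q t)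
  let dqt : ℝ → Fin r → ℝ := fun t => (-(η * c)) • (c • ((A t)ᵀ *ᵥ (A t *ᵥ q t)) - σ • p t)
  have hdp : ∀ t, 0 ≤ t → ∀ k, HasDerivAt (fun s => p s k) (dpt t k) t := by
    intro t ht k
    have h1 : HasDerivAt (fun s => ∑ i, A s i k * v i)
        (∑ i, ((-η) • ((lG α M (A t) (B t))ᵀ * B t)) i k * v i) t :=
      HasDerivAt.fun_sum fun i _ => ((hflow t ht).1 i k).mul_const (v i)
    have h2 : (((-η) • ((lG α M (A t) (B t))ᵀ * B t))ᵀ *ᵥ v) = dpt t := by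
      simp only [dpt, hp, hq, lG, lX, ← hc, transpose_smul, transpose_mul, transpose_transpose,
        smul_mulVec, ← mulVec_mulVec, sub_mulVec, hMv, mulVec_smul, mulVec_sub, smul_smul,
        smul_sub]
      simp only [neg_mul, mul_assoc]
    have h3 := congrFun h2 k
    simp only [mulVec, dotProduct, transpose_apply] at h3
    rw [h3] at h1
    exact h1
  have hdq : ∀ t, 0 ≤ t → ∀ k, HasDerivAt (fun s => q s k) (dqt t k) t := by
    intro t ht k
    have h1 : HasDerivAt (fun s => ∑ i, B s i k * u i)
        (∑ i, ((-η) • (lG α M (A t) (B t) * A t)) i k * u i) t :=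
      HasDerivAt.fun_sum fun i _ => ((hflow t ht).2 i k).mul_const (u i)
    have h2 : (((-η) • (lG α M (A t) (B t) * A t))ᵀ *ᵥ u) = dqt t := by
      simp only [dqt, hp, hq, lG, lX, ← hc, transpose_smul, transpose_mul, transpose_transpose,
        transpose_sub, smul_mulVec, ← mulVec_mulVec, sub_mulVec, hMu, mulVec_smul, mulVec_sub,
        smul_smul, smul_sub]
      simp only [neg_mul, mul_assoc]
    have h3 := congrFun h2 k
    simp only [mulVec, dotProduct, transpose_apply] at h3
    rw [h3] at h1
    exact h1
  let E : ℝ → ℝ := fun t => p t ⬝ᵥ p t + q t ⬝ᵥ q t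
  have hdE : ∀ t, 0 ≤ t → HasDerivAt E (2 * (p t ⬝ᵥ dpt t) + 2 * (q t ⬝ᵥ dqt t)) t := by
    intro t ht
    have h1 : HasDerivAt (fun s => (∑ k, p s k * p s k) + ∑ k, q s k * q s k)
        ((∑ k, (dpt t k * p t k + p t k * dpt t k)) + ∑ k, (dqt t k * q t k + q t k * dqt t k)) t :=
      (HasDerivAt.fun_sum fun k _ => (hdp t ht k).mul (hdp t ht k)).add
        (HasDerivAt.fun_sum fun k _ => (hdq t ht k).mul (hdq t ht k))
    have h2 : 2 * (p t ⬝ᵥ dpt t) + 2 * (q t ⬝ᵥ dqt t) =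
        (∑ k, (dpt t k * p t k + p t k * dpt t k)) + ∑ k, (dqt t k * q t k + q t k * dqt t k) := by
      simp only [dotProduct, Finset.mul_sum]
      congr 1 <;> exact Finset.sum_congr rfl fun k _ => by ring
    rw [h2]
    exact h1
  have hbound : ∀ t, 2 * (p t ⬝ᵥ dpt t) + 2 * (q t ⬝ᵥ dqt t) ≤ 2 * η * c * σ * E t := by
    intro t
    have e1 : p t ⬝ᵥ dpt t = -(η * c) * (c * ((B t *ᵥ p t) ⬝ᵥ (B t *ᵥ p t)) - σ * (p t ⬝ᵥ q t)) := by
      simp only [dpt, dotProduct_smul, dotProduct_sub, smul_eq_mul]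
      rw [dotProduct_mulVec, vecMul_transpose]
    have e2 : q t ⬝ᵥ dqt t = -(η * c) * (c * ((A t *ᵥ q t) ⬝ᵥ (A t *ᵥ q t)) - σ * (p t ⬝ᵥ q t)) := by
      simp only [dqt, dotProduct_smul, dotProduct_sub, smul_eq_mul]
      rw [dotProduct_mulVec, vecMul_transpose, dotProduct_comm (q t) (p t)]
    have n1 : 0 ≤ (B t *ᵥ p t) ⬝ᵥ (B t *ᵥ p t) := Finset.sum_nonneg fun i _ => mul_self_nonneg _
    have n2 : 0 ≤ (A t *ᵥ q t) ⬝ᵥ (A t *ᵥ q t) := Finset.sum_nonneg fun i _ => mul_self_nonneg _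
    have n3 : 0 ≤ (p t - q t) ⬝ᵥ (p t - q t) := Finset.sum_nonneg fun i _ => mul_self_nonneg _
    have e3 : (p t - q t) ⬝ᵥ (p t - q t) = E t - 2 * (p t ⬝ᵥ q t) := by
      simp only [E, dotProduct_sub, sub_dotProduct, dotProduct_comm (q t) (p t)]
      ring
    rw [e3] at n3
    rw [e1, e2]
    have k0 : 0 ≤ η * c * c := by positivity
    have k1 : 0 ≤ η * c * σ := by positivity
    nlinarith [mul_nonneg k0 n1, mul_nonneg k0 n2, mul_nonneg k1 n3]
  set K : ℝ := 2 * η * c * σ with hK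
  have hdF : ∀ t, 0 ≤ t → HasDerivAt (fun s => E s * Real.exp (-K * s))
      ((2 * (p t ⬝ᵥ dpt t) + 2 * (q t ⬝ᵥ dqt t)) * Real.exp (-K * t)
        + E t * (Real.exp (-K * t) * (-K * 1))) t := fun t ht =>
    (hdE t ht).mul (((hasDerivAt_id t).const_mul (-K)).exp)
  have hanti : AntitoneOn (fun s => E s * Real.exp (-K * s)) (Set.Ici 0) := by
    refine antitoneOn_of_deriv_nonpos (convex_Ici 0)
      (fun t ht => (hdF t ht).continuousAt.continuousWithinAt) ?_ ?_
    · intro t ht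
      rw [interior_Ici] at ht
      exact (hdF t (le_of_lt ht)).differentiableAt.differentiableWithinAt
    · intro t ht
      rw [interior_Ici] at ht
      rw [(hdF t (le_of_lt ht)).deriv]
      nlinarith [mul_nonneg (sub_nonneg.mpr (hbound t)) (Real.exp_pos (-K * t)).le]
  intro t ht
  have hE0 : E 0 = 0 := by
    have h1 : p 0 = 0 := hp0
    have h2 : q 0 = 0 := hq0
    simp [E, h1, h2]
  have hEt : E t ≤ 0 := by
    have h := hanti (Set.mem_Ici.mpr le_rfl) (Set.mem_Ici.mpr ht) ht
    simp only [hE0, zero_mul] at h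
    by_contra hh
    exact absurd h (not_le.mpr (mul_pos (not_le.mp hh) (Real.exp_pos _)))
  have m1 : 0 ≤ p t ⬝ᵥ p t := Finset.sum_nonneg fun i _ => mul_self_nonneg _
  have m2 : 0 ≤ q t ⬝ᵥ q t := Finset.sum_nonneg fun i _ => mul_self_nonneg _
  have hEt' : p t ⬝ᵥ p t + q t ⬝ᵥ q t ≤ 0 := hEt
  have hpt : (A t)ᵀ *ᵥ v = 0 := dotProduct_self_eq_zero.mp (show p t ⬝ᵥ p t = 0 by linarith)
  have hqt : (B t)ᵀ *ᵥ u = 0 := dotProduct_self_eq_zero.mp (show q t ⬝ᵥ q t = 0 by linarith)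
  refine ⟨?_, ?_, ?_, ?_⟩ <;>
    simp only [lX, lY, lZ, transpose_smul, transpose_mul, transpose_transpose, smul_mulVec,
      ← mulVec_mulVec, hpt, hqt, mulVec_zero, smul_zero]

end
end
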